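/- Suppose the HNN-extension 𝔼 = ⟨B, t; t⁻¹Ht = K, φ⟩ satisfies condition (*) and 𝒞 is a root class of groups closed under taking quotient groups. Suppose also that 𝔉 ∈ 𝒞 and conditions (†) and (‡) hold. If B/H and B/K are residually 𝒞-groups and every subgroup belonging to 𝒞*(B) contains a pre-𝒞-admissible subgroup, then 𝔼 is residually a 𝒞-group if and only if B is residually a 𝒞-group. -/

import Mathlib

universe u

open Subgroup

/-- A class of groups in universe `u`: a property of groups. -/
abbrev GroupClass : Type (u + 1) := (G : Type u) → [inst : Group G] → Prop

/-- The class is closed under isomorphism. -/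
def IsoClosed (C : GroupClass.{u}) : Prop :=
  ∀ (G₁ G₂ : Type u) [Group G₁] [Group G₂], (G₁ ≃* G₂) → C G₁ → C G₂

/-- The class is closed under taking subgroups. -/
def SubgroupClosed (C : GroupClass.{u}) : Prop :=
  ∀ (G : Type u) [Group G] (H : Subgroup G), C G → C H

/-- The class is closed under taking quotient groups. -/
def QuotClosed (C : GroupClass.{u}) : Prop :=
  ∀ (G : Type u) [Group G] (N : Subgroup G) [N.Normal], C G → C (G ⧸ N)

/-- The class is closed under direct products of a finite number of factors. -/
def FinProdClosed (C : GroupClass.{u}) : Prop :=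
  ∀ (ι : Type u) [Finite ι] (G : ι → Type u) [∀ i, Group (G i)],
    (∀ i, C (G i)) → C (∀ i, G i)

/-- Gruenberg's condition. -/
def Gruenberg (C : GroupClass.{u}) : Prop :=
  ∀ (X : Type u) [Group X] (Y Z : Subgroup X) (_ : Z ≤ Y) (hY : Y.Normal)
    (hZY : (Z.subgroupOf Y).Normal), C (X ⧸ Y) → C (↥Y ⧸ Z.subgroupOf Y) →
    ∃ T : Subgroup X, ∃ _ : T.Normal, T ≤ Z ∧ C (X ⧸ T)

/-- A root class of groups. -/
def IsRootClass (C : GroupClass.{u}) : Prop :=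
  IsoClosed C ∧ (∃ (G : Type u) (_ : Group G), C G ∧ Nontrivial G) ∧
    SubgroupClosed C ∧ Gruenberg C

/-- `X` is residually a `C`-group. -/
def Residually (C : GroupClass.{u}) (X : Type u) [Group X] : Prop :=
  ∀ x : X, x ≠ 1 → ∃ (G : Type u) (_ : Group G) (f : X →* G),
    Function.Surjective f ∧ C G ∧ f x ≠ 1

/-- Every element has finite order. -/
def Periodic (G : Type u) [Group G] : Prop := ∀ g : G, IsOfFinOrder g

/-- The class consists only of periodic groups. -/
def PeriodicClass (C : GroupClass.{u}) : Prop := ∀ (G : Type u) [Group G], C G → Periodic G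

/-- `Aut_X(Y)`: the subgroup of `Aut(Y)` consisting of the restrictions to `Y`
of the inner automorphisms of `X` (that leave `Y` invariant; when `Y` is normal
in `X` these are the restrictions of all inner automorphisms of `X`). -/
def autOf (X : Type u) [Group X] (Y : Subgroup X) : Subgroup (MulAut Y) where
  carrier := { α | ∃ x : X, ∀ y : Y, ((α y : Y) : X) = x * y * x⁻¹ }
  one_mem' := ⟨1, fun y => by simp⟩
  mul_mem' := by
    rintro α β ⟨a, ha⟩ ⟨b, hb⟩
    refine ⟨a * b, fun y => ?_⟩
    have h1 : ((α (β y) : Y) : X) = a * (β y) * a⁻¹ := ha (β y)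
    have h2 : ((β y : Y) : X) = b * y * b⁻¹ := hb y
    show ((α (β y) : Y) : X) = _
    rw [h1, h2]; group
  inv_mem' := by
    rintro α ⟨a, ha⟩
    refine ⟨a⁻¹, fun y => ?_⟩
    have h : ((α (α⁻¹ y) : Y) : X) = a * (α⁻¹ y) * a⁻¹ := ha (α⁻¹ y)
    rw [MulAut.apply_inv_self] at h
    rw [h]; group

/-- Conjugation of automorphism groups along an isomorphism `φ : H ≃* K`,
giving `φ ∘ α ∘ φ⁻¹ : Aut K →* Aut H`. -/
def autConjHom {H K : Type u} [Group H] [Group K] (φ : H ≃* K) : MulAut K →* MulAut H where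
  toFun α := (φ.trans α).trans φ.symm
  map_one' := by ext x; simp
  map_mul' := fun α β => by
    ext x
    simp [MulAut.mul_apply, MulEquiv.trans_apply, MulEquiv.apply_symm_apply]

/-- `N ∈ 𝒞*(X)`: `N` is normal in `X` and `X/N ∈ 𝒞`. -/
def inCStar (C : GroupClass.{u}) (X : Type u) [Group X] (N : Subgroup X) : Prop :=
  ∃ _ : N.Normal, C (X ⧸ N)

/-- `X` is `𝒞`-quasi-regular with respect to its subgroup `Y`. -/
def QuasiRegular (C : GroupClass.{u}) (X : Type u) [Group X] (Y : Subgroup X) : Prop :=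
  ∀ M : Subgroup Y, inCStar C Y M → ∃ N : Subgroup X, inCStar C X N ∧ N.subgroupOf Y ≤ M

/-- `𝔓(𝒞)`: the set of primes dividing the order of some element of some `𝒞`-group. -/
def primesOf (C : GroupClass.{u}) : Set ℕ :=
  { p | p.Prime ∧ ∃ (Z : Type u) (_ : Group Z), C Z ∧ ∃ z : Z, p ∣ orderOf z }

/-- `Y` is `𝔓(𝒞)′`-isolated in `X`. -/
def PIsolated (C : GroupClass.{u}) {X : Type u} [Group X] (Y : Subgroup X) : Prop :=
  ∀ (x : X) (q : ℕ), q.Prime → q ∉ primesOf C → x ^ q ∈ Y → x ∈ Y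

/-- Every finitely generated subgroup is cyclic. -/
def LocallyCyclic (G : Type u) [Group G] : Prop :=
  ∀ S : Subgroup G, S.FG → IsCyclic S

/-- `A` is a `𝒞`-bounded abelian group. -/
def CBoundedAbelian (C : GroupClass.{u}) (A : Type u) [Group A] : Prop :=
  (∀ a b : A, a * b = b * a) ∧
  ∀ (N : Subgroup A), ∀ _ : N.Normal, ∀ p ∈ primesOf C,
    (∃ m : ℕ, 0 < m ∧ ∀ x : A ⧸ N, (∃ n : ℕ, x ^ p ^ n = 1) → x ^ m = 1) ∧
    (∃ (Z : Type u) (_ : Group Z), C Z ∧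
      Cardinal.mk {x : A ⧸ N // ∃ n : ℕ, x ^ p ^ n = 1} ≤ Cardinal.mk Z)

/-- `X` is a `𝒞`-bounded nilpotent group: it has a finite central series with
`𝒞`-bounded abelian factors. -/
def CBoundedNilpotent (C : GroupClass.{u}) (X : Type u) [Group X] : Prop :=
  ∃ (n : ℕ) (S : ℕ → Subgroup X), S 0 = ⊥ ∧ S n = ⊤ ∧
    (∀ i < n, S i ≤ S (i + 1)) ∧ (∀ i < n, (S i).Normal) ∧
    (∀ i < n, ∀ x ∈ S (i + 1), ∀ g : X, g⁻¹ * x⁻¹ * g * x ∈ S i) ∧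
    (∀ i < n, ∀ _ : ((S i).subgroupOf (S (i + 1))).Normal,
      CBoundedAbelian C (↥(S (i + 1)) ⧸ (S i).subgroupOf (S (i + 1))))

/-- `A` is a normal subgroup of `U` (as subgroups of a common group). -/
def NormalIn {G : Type u} [Group G] (A U : Subgroup G) : Prop := (A.subgroupOf U).Normal

/-- `G` satisfies a non-trivial identity. -/
def SatisfiesNontrivialIdentity (G : Type u) [Group G] : Prop :=
  ∃ w : FreeGroup ℕ, w ≠ 1 ∧ ∀ f : FreeGroup ℕ →* G, f w = 1

section HNN

variable {B : Type u} [Group B] (H K : Subgroup B) (φ : H ≃* K)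

/-- `𝔎 = φ ∘ Aut_B(K) ∘ φ⁻¹`, as a subgroup of `Aut(H)`. -/
def frakK : Subgroup (MulAut H) := (autOf B K).map (autConjHom φ)

/-- `𝔘 = ⟨𝔥, 𝔎⟩ ≤ Aut(H)`. -/
def frakU : Subgroup (MulAut H) := autOf B H ⊔ frakK H K φ

/-- `𝔙 = ⟨𝔏, 𝔉⟩ ≤ Aut(L)`, where `ψ = φ|_L`. -/
def frakV (ψ : MulAut ↥(H ⊓ K)) : Subgroup (MulAut ↥(H ⊓ K)) :=
  autOf B (H ⊓ K) ⊔ Subgroup.zpowers ψ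

/-- `ψ` is the restriction of `φ` to `L = H ⊓ K` (this encodes the
`φ`-invariance of `L` from condition (*)). -/
def IsRestrictionToL (ψ : MulAut ↥(H ⊓ K)) : Prop :=
  ∀ x : ↥(H ⊓ K), ((ψ x : ↥(H ⊓ K)) : B) = ((φ ⟨(x : B), x.2.1⟩ : K) : B)

/-- `(H ⊓ K)φ = H ⊓ K` : the `φ`-invariance of `L` from condition (*). -/
def PhiInvL : Prop :=
  ((H ⊓ K).subgroupOf H).map φ.toMonoidHom = (H ⊓ K).subgroupOf K

end HNN

section HNNExtra

variable (C : GroupClass.{u}) {B : Type u} [Group B] (H K : Subgroup B) (φ : H ≃* K)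

/-- Condition (†): at least one of `𝔥` and `𝔎` is normal in `𝔘`, or `𝔘 ∈ 𝒞`. -/
def CondDag : Prop :=
  NormalIn (autOf B H) (frakU H K φ) ∨ NormalIn (frakK H K φ) (frakU H K φ) ∨
    C ↥(frakU H K φ)

/-- Condition (‡): at least one of `𝔏` and `𝔉` is normal in `𝔙`, or `𝔙 ∈ 𝒞`. -/
def CondDDag (ψ : MulAut ↥(H ⊓ K)) : Prop :=
  NormalIn (autOf B (H ⊓ K)) (frakV H K ψ) ∨
    NormalIn (Subgroup.zpowers ψ) (frakV H K ψ) ∨ C ↥(frakV H K ψ)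

/-- `Q` is a pre-`𝒞`-admissible subgroup of `B`: it is normal, `(H,K,φ)`-compatible,
`B/Q ∈ 𝒞`, and `HQ/Q ∩ KQ/Q = LQ/Q`. -/
def PreAdmissible (Q : Subgroup B) : Prop :=
  ∃ _ : Q.Normal, ((Q ⊓ H).subgroupOf H).map φ.toMonoidHom = (Q ⊓ K).subgroupOf K ∧
    C (B ⧸ Q) ∧
    (H.map (QuotientGroup.mk' Q)) ⊓ (K.map (QuotientGroup.mk' Q)) =
      (H ⊓ K).map (QuotientGroup.mk' Q)

end HNNExtra

section ClassClosure

variable {C : GroupClass.{u}}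

lemma IsRootClass.congr (hC : IsRootClass C) {G P : Type u} [Group G] [Group P] (e : G ≃* P)
    (h : C G) : C P :=
  hC.1 G P e h

lemma IsRootClass.of_injective (hC : IsRootClass C) {G P : Type u} [Group G] [Group P]
    (f : G →* P) (hf : Function.Injective f) (h : C P) : C G :=
  hC.congr (MonoidHom.ofInjective hf).symm (hC.2.2.1 P f.range h)

lemma IsRootClass.of_le (hC : IsRootClass C) {G : Type u} [Group G] {S T : Subgroup G}
    (hST : S ≤ T) (h : C T) : C S :=
  hC.of_injective (inclusion hST) (inclusion_injective hST) h

lemma IsRootClass.of_surjective (hC : IsRootClass C) (hquot : QuotClosed C) {G P : Type u}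
    [Group G] [Group P] (f : G →* P) (hf : Function.Surjective f) (h : C G) : C P :=
  hC.congr (QuotientGroup.quotientKerEquivOfSurjective f hf) (hquot G f.ker h)

lemma IsRootClass.range (hC : IsRootClass C) (hquot : QuotClosed C) {G P : Type u}
    [Group G] [Group P] (f : G →* P) (h : C G) : C f.range :=
  hC.of_surjective hquot f.rangeRestrict f.rangeRestrict_surjective h

/-- Gruenberg's condition, phrased with homomorphisms. -/
lemma IsRootClass.exists_hom (hC : IsRootClass C) {G P P' : Type u} [Group G] [Group P]
    [Group P'] (f : G →* P) (g : f.ker →* P') (hP : C P) (hP' : C P') :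
    ∃ (X : Type u) (_ : Group X) (q : G →* X), C X ∧
      ∀ x, q x = 1 → ∃ hx : x ∈ f.ker, g ⟨x, hx⟩ = 1 := by
  have hle : g.ker.map f.ker.subtype ≤ f.ker := map_subtype_le _
  have hsub : (g.ker.map f.ker.subtype).subgroupOf f.ker = g.ker :=
    comap_map_eq_self_of_injective (subtype_injective _) _
  have hn : ((g.ker.map f.ker.subtype).subgroupOf f.ker).Normal := by
    rw [hsub]; infer_instance
  have h1 : C (G ⧸ f.ker) := hC.of_injective _ (QuotientGroup.kerLift_injective f) hP
  have h2 : C (f.ker ⧸ (g.ker.map f.ker.subtype).subgroupOf f.ker) :=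
    hC.congr (QuotientGroup.quotientMulEquivOfEq hsub).symm
      (hC.of_injective _ (QuotientGroup.kerLift_injective g) hP')
  obtain ⟨T, hT, hTle, hCT⟩ := hC.2.2.2 G f.ker _ hle inferInstance hn h1 h2
  refine ⟨G ⧸ T, inferInstance, QuotientGroup.mk' T, hCT, fun x hx => ?_⟩
  have hxT : x ∈ T := (QuotientGroup.eq_one_iff x).1 hx
  obtain ⟨y, hy, rfl⟩ := hTle hxT
  exact ⟨y.2, hy⟩

lemma IsRootClass.of_ker (hC : IsRootClass C) {G P : Type u} [Group G] [Group P] (f : G →* P)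
    (hP : C P) (hk : C f.ker) : C G := by
  obtain ⟨X, _, q, hX, hq⟩ := hC.exists_hom f (MonoidHom.id _) hP hk
  refine hC.of_injective q ((injective_iff_map_eq_one q).2 fun x hx => ?_) hX
  obtain ⟨_, h⟩ := hq x hx
  exact congrArg Subtype.val h

lemma IsRootClass.prod (hC : IsRootClass C) {G P : Type u} [Group G] [Group P] (hG : C G)
    (hP : C P) : C (G × P) := by
  refine hC.of_ker (MonoidHom.snd G P) hP (hC.of_injective
    ((MonoidHom.fst G P).comp (MonoidHom.snd G P).ker.subtype) ?_ hG)
  rintro ⟨⟨a, b⟩, hb : b = 1⟩ ⟨⟨c, d⟩, hd : d = 1⟩ (h : a = c)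
  subst hb hd h
  rfl

lemma IsRootClass.semidirect (hC : IsRootClass C) {N G : Type u} [Group N] [Group G]
    (a : G →* MulAut N) (hN : C N) (hG : C G) : C (N ⋊[a] G) := by
  refine hC.of_ker SemidirectProduct.rightHom hG ?_
  rw [← SemidirectProduct.range_inl_eq_ker_rightHom]
  exact hC.congr (MonoidHom.ofInjective SemidirectProduct.inl_injective) hN

lemma IsRootClass.wreath (hC : IsRootClass C) {D Q : Type u} [Group D] [Group Q]
    (hD : C D) (hQ : C Q) : C (D ≀ᵣ Q) := by
  let g : (RegularWreathProduct.rightHom : D ≀ᵣ Q →* Q).ker →* D :=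
    { toFun := fun x => x.1.left 1
      map_one' := rfl
      map_mul' := by
        rintro ⟨x, hx⟩ ⟨y, hy⟩
        have hx' : x.right = 1 := hx
        simp [hx'] }
  obtain ⟨X, _, q, hX, hq⟩ := hC.exists_hom _ g hQ hD
  refine hC.of_injective q ((injective_iff_map_eq_one q).2 fun x hx => ?_) hX
  obtain ⟨hx1 : x.right = 1, -⟩ := hq x hx
  ext k
  · obtain ⟨_, h⟩ := hq (RegularWreathProduct.inl k⁻¹ * x * (RegularWreathProduct.inl k⁻¹)⁻¹)
      (by simp [hx])
    simpa [g] using h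
  · exact hx1

lemma IsRootClass.exists_trivial (hC : IsRootClass C) :
    ∃ (G : Type u) (_ : Group G), C G := by
  obtain ⟨G, _, h, -⟩ := hC.2.1
  exact ⟨G, _, h⟩

lemma IsRootClass.residually_iff (hC : IsRootClass C) {G : Type u} [Group G] :
    Residually C G ↔ ∀ x : G, x ≠ 1 → ∃ (P : Type u) (_ : Group P) (f : G →* P),
      C P ∧ f x ≠ 1 := by
  refine ⟨fun h x hx => ?_, fun h x hx => ?_⟩
  · obtain ⟨P, _, f, -, hP, hf⟩ := h x hx
    exact ⟨P, _, f, hP, hf⟩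
  · obtain ⟨P, _, f, hP, hf⟩ := h x hx
    refine ⟨f.range, inferInstance, f.rangeRestrict, f.rangeRestrict_surjective,
      hC.2.2.1 P _ hP, fun h1 => hf ?_⟩
    exact congrArg Subtype.val h1

lemma Residually.of_injective (hC : IsRootClass C) {G P : Type u} [Group G] [Group P]
    (f : G →* P) (hf : Function.Injective f) (h : Residually C P) : Residually C G := by
  rw [hC.residually_iff] at h ⊢
  intro x hx
  obtain ⟨X, _, q, hX, hq⟩ := h (f x) (fun h1 => hx (hf (h1.trans f.map_one.symm)))
  exact ⟨X, _, q.comp f, hX, hq⟩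

end ClassClosure

section FreeGroups

variable {C : GroupClass.{u}}

/-- The value of a word in the letters `s` and their formal inverses under `f`. -/
def wordEval {S : Type*} {G : Type*} [Group G] (f : S → G) (L : List (S × Bool)) : G :=
  (L.map fun x => cond x.2 (f x.1) (f x.1)⁻¹).prod

section wordEval

variable {S : Type*} {G : Type*} [Group G] (f : S → G)

@[simp] lemma wordEval_nil : wordEval f [] = 1 := rfl

@[simp] lemma wordEval_cons (a : S × Bool) (L : List (S × Bool)) :
    wordEval f (a :: L) = cond a.2 (f a.1) (f a.1)⁻¹ * wordEval f L := by
  simp [wordEval]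

@[simp] lemma wordEval_append (L M : List (S × Bool)) :
    wordEval f (L ++ M) = wordEval f L * wordEval f M := by
  simp [wordEval]

lemma map_wordEval {P : Type*} [Group P] (q : G →* P) (L : List (S × Bool)) :
    q (wordEval f L) = wordEval (fun s => q (f s)) L := by
  induction L with
  | nil => simp
  | cons a L ih => rcases a with ⟨s, _ | _⟩ <;> simp [ih]

end wordEval

open Classical in
/-- A lift of `f : S → G` to a wreath product, recording the passages of a path in the Cayley
graph of `G` through the edges labelled by `s₀`. -/
noncomputable def edgeLift {S G Q : Type*} [Group G] [Group Q] (f : S → G) (s₀ : S) (g : Q) :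
    S → Q ≀ᵣ G :=
  fun s => ⟨fun x => if s = s₀ ∧ x = 1 then g else 1, f s⟩

lemma wordEval_edgeLift_left_eq_one {S G Q : Type*} [Group G] [Group Q] (f : S → G) (s₀ : S)
    (g : Q) (L : List (S × Bool)) (x : G)
    (h : ∀ l₁ e l₂, L = l₁ ++ (s₀, e) :: l₂ →
      (e = true → wordEval f l₁ ≠ x) ∧ (e = false → wordEval f (l₁ ++ [(s₀, e)]) ≠ x)) :
    (wordEval (edgeLift f s₀ g) L).left x = 1 := by
  induction L generalizing x with
  | nil => simp
  | cons a L ih =>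
    obtain ⟨s, b⟩ := a
    have key : ∀ y, y = (cond b (f s) (f s)⁻¹)⁻¹ * x →
        (wordEval (edgeLift f s₀ g) L).left y = 1 := by
      rintro y rfl
      refine ih _ fun l₁ e l₂ hL => ?_
      have := h ((s, b) :: l₁) e l₂ (by simp [hL])
      simpa [eq_inv_mul_iff_mul_eq, mul_assoc] using this
    have h0 : s = s₀ → (b = true → (1 : G) ≠ x) ∧ (b = false → (f s)⁻¹ ≠ x) := by
      rintro rfl
      have := h [] b L rfl
      cases b <;> simpa using this
    cases b with
    | true =>
      rw [wordEval_cons]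
      simp only [cond_true, RegularWreathProduct.mul_left, Pi.mul_apply]
      rw [key _ (by simp [edgeLift]), mul_one]
      have : ¬ (s = s₀ ∧ x = 1) := fun hx => (h0 hx.1).1 rfl hx.2.symm
      simp [edgeLift, this]
    | false =>
      rw [wordEval_cons]
      simp only [cond_false, RegularWreathProduct.mul_left, Pi.mul_apply]
      rw [key _ (by simp [edgeLift]), mul_one]
      have : ¬ (s = s₀ ∧ f s * x = 1) := fun hx =>
        (h0 hx.1).2 rfl (inv_eq_of_mul_eq_one_right hx.2)
      simp [edgeLift, this]

lemma wordEval_edgeLift_ne_one {S G Q : Type*} [Group G] [Group Q] (f : S → G) {g : Q}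
    (hg : g ≠ 1) (s₀ : S) (e₀ : Bool) (M : List (S × Bool))
    (hred : FreeGroup.IsReduced ((s₀, e₀) :: M))
    (h : ∀ v, v ≠ [] → v <:+: ((s₀, e₀) :: M) → v ≠ (s₀, e₀) :: M → wordEval f v ≠ 1) :
    wordEval (edgeLift f s₀ g) ((s₀, e₀) :: M) ≠ 1 := by
  have hne : ∀ l₁ l₂ : List (S × Bool), M = l₁ ++ (s₀, !e₀) :: l₂ → wordEval f l₁ ≠ 1 := by
    intro l₁ l₂ hM
    refine h l₁ ?_ ⟨[(s₀, e₀)], (s₀, !e₀) :: l₂, by simp [hM]⟩ ?_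
    · rintro rfl
      subst hM
      simpa using (FreeGroup.isReduced_cons_cons.1 hred).1
    · intro h1
      have := congrArg List.length h1
      rw [hM] at this
      simp at this
      omega
  intro h1
  have h2 := fun x => congrFun (congrArg RegularWreathProduct.left h1) x
  cases e₀ with
  | true =>
    have hM : (wordEval (edgeLift f s₀ g) M).left (f s₀)⁻¹ = 1 := by
      refine wordEval_edgeLift_left_eq_one f s₀ g M _ fun l₁ e l₂ hL => ⟨?_, ?_⟩
      · rintro rfl h3
        refine h ((s₀, true) :: l₁) (by simp) ⟨[], (s₀, true) :: l₂, by simp [hL]⟩ ?_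
          (by simp [h3])
        intro h4
        have := congrArg List.length h4
        rw [hL] at this
        simp at this
      · rintro rfl h3
        exact hne l₁ l₂ hL (by simpa using h3)
    have := h2 1
    rw [wordEval_cons] at this
    simp only [cond_true, RegularWreathProduct.mul_left, Pi.mul_apply] at this
    rw [show (edgeLift f s₀ g s₀).right⁻¹ * 1 = (f s₀)⁻¹ by simp [edgeLift], hM] at this
    exact hg (by simpa [edgeLift] using this)
  | false =>
    have hM : (wordEval (edgeLift f s₀ g) M).left 1 = 1 := by
      refine wordEval_edgeLift_left_eq_one f s₀ g M _ fun l₁ e l₂ hL => ⟨?_, ?_⟩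
      · rintro rfl h3
        exact hne l₁ l₂ hL h3
      · rintro rfl
        refine h _ (by simp) ⟨[(s₀, false)], l₂, by simp [hL]⟩ ?_
        intro h4
        have := congrArg List.length h4
        rw [hL] at this
        simp at this
    have := h2 (f s₀)⁻¹
    rw [wordEval_cons] at this
    simp only [cond_false, RegularWreathProduct.mul_left, Pi.mul_apply] at this
    rw [show (edgeLift f s₀ g s₀)⁻¹.right⁻¹ * (f s₀)⁻¹ = 1 by simp [edgeLift], hM] at this
    exact hg (by simpa [edgeLift] using this)

lemma List.IsInfix.tail_or_dropLast {α : Type*} {v L : List α} (h : v <:+: L) (hne : v ≠ L) :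
    v <:+: L.tail ∨ v <:+: L.dropLast := by
  obtain ⟨s, t, rfl⟩ := h
  rcases s with _ | ⟨a, s⟩
  · right
    have ht : t ≠ [] := by
      rintro rfl
      simp at hne
    rw [List.dropLast_append_of_ne_nil ht]
    exact ⟨[], t.dropLast, by simp⟩
  · left
    exact ⟨s, t, by simp⟩

lemma IsRootClass.exists_wordEval_ne_one (hC : IsRootClass C) {S : Type u} (n : ℕ) :
    ∀ L : List (S × Bool), FreeGroup.IsReduced L → L.length = n →
      ∃ (G : Type u) (_ : Group G) (f : S → G), C G ∧
        ∀ v, v ≠ [] → v <:+: L → wordEval f v ≠ 1 := by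
  induction n with
  | zero =>
    intro L _ hL
    obtain ⟨G, _, hG⟩ := hC.exists_trivial
    refine ⟨G, _, fun _ => 1, hG, fun v hv hvL => absurd ?_ hv⟩
    rw [List.length_eq_zero_iff] at hL
    simpa [hL] using hvL
  | succ n ih =>
    intro L hred hL
    obtain ⟨G₁, _, f₁, hG₁, h₁⟩ := ih L.tail (hred.infix (List.tail_suffix L).isInfix) (by simp [hL])
    obtain ⟨G₂, _, f₂, hG₂, h₂⟩ := ih L.dropLast (hred.infix (List.dropLast_prefix L).isInfix)
      (by simp [hL])
    let f : S → G₁ × G₂ := fun s => (f₁ s, f₂ s)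
    have hf : ∀ v, v ≠ [] → v <:+: L → v ≠ L → wordEval f v ≠ 1 := by
      intro v hv hvL hne h
      rcases hvL.tail_or_dropLast hne with h' | h'
      · exact h₁ v hv h' (by simpa [map_wordEval] using congrArg (MonoidHom.fst G₁ G₂) h)
      · exact h₂ v hv h' (by simpa [map_wordEval] using congrArg (MonoidHom.snd G₁ G₂) h)
    by_cases hfL : wordEval f L = 1
    · obtain ⟨Q, _, hQ, hnt⟩ := hC.2.1
      obtain ⟨g, hg⟩ := exists_ne (1 : Q)
      obtain ⟨⟨s₀, e₀⟩, M, rfl⟩ := List.exists_cons_of_length_eq_add_one hL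
      refine ⟨Q ≀ᵣ (G₁ × G₂), inferInstance, edgeLift f s₀ g, hC.wreath hQ (hC.prod hG₁ hG₂), ?_⟩
      intro v hv hvL
      by_cases hvne : v = (s₀, e₀) :: M
      · subst hvne
        exact wordEval_edgeLift_ne_one f hg s₀ e₀ M hred hf
      · intro h
        refine hf v hv hvL hvne ?_
        exact (map_wordEval (edgeLift f s₀ g) RegularWreathProduct.rightHom v).symm.trans
          (congrArg RegularWreathProduct.rightHom h)
    · refine ⟨G₁ × G₂, inferInstance, f, hC.prod hG₁ hG₂, fun v hv hvL => ?_⟩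
      by_cases hvne : v = L
      · rwa [hvne]
      · exact hf v hv hvL hvne

lemma IsRootClass.exists_freeGroup_hom_ne_one (hC : IsRootClass C) {S : Type u} (w : FreeGroup S)
    (hw : w ≠ 1) : ∃ (G : Type u) (_ : Group G) (f : FreeGroup S →* G), C G ∧ f w ≠ 1 := by
  classical
  obtain ⟨G, _, f, hG, h⟩ := hC.exists_wordEval_ne_one _ w.toWord
    (FreeGroup.isReduced_toWord) rfl
  refine ⟨G, _, FreeGroup.lift f, hG, ?_⟩
  have := h w.toWord (by simpa using hw) List.infix_rfl
  rwa [wordEval, ← FreeGroup.lift_mk, FreeGroup.mk_toWord] at this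

/-- A semidirect product of a free group and a `C`-group is residually a `C`-group. -/
lemma IsRootClass.exists_semidirect_hom_ne_one (hC : IsRootClass C) {S X : Type u} [Group X]
    (a : X →* MulAut (FreeGroup S)) (hX : C X) (w : FreeGroup S ⋊[a] X) (hw : w ≠ 1) :
    ∃ (G : Type u) (_ : Group G) (f : FreeGroup S ⋊[a] X →* G), C G ∧ f w ≠ 1 := by
  by_cases hr : w.right = 1
  · have hl : w.left ≠ 1 := fun h => hw (by ext <;> simp [h, hr])
    obtain ⟨P, _, p, hP, hp⟩ := hC.exists_freeGroup_hom_ne_one _ hl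
    let l : (SemidirectProduct.rightHom : FreeGroup S ⋊[a] X →* X).ker →* FreeGroup S :=
      { toFun := fun x => x.1.left
        map_one' := rfl
        map_mul' := by
          rintro ⟨x, hx⟩ ⟨y, hy⟩
          have hx' : x.right = 1 := hx
          simp [hx'] }
    obtain ⟨G, _, q, hG, hq⟩ := hC.exists_hom _ (p.comp l) hX hP
    refine ⟨G, _, q, hG, fun h => hp ?_⟩
    obtain ⟨_, h'⟩ := hq w h
    exact h'
  · exact ⟨X, _, SemidirectProduct.rightHom, hX, hr⟩

end FreeGroups

section InducedMaps

lemma exists_mulEquiv_of_ker_eq {G P P' : Type*} [Group G] [Group P] [Group P'] (f : G →* P)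
    (g : G →* P') (hf : Function.Surjective f) (hg : Function.Surjective g)
    (h : ∀ x, f x = 1 ↔ g x = 1) : ∃ e : P ≃* P', ∀ x, e (f x) = g x := by
  have hk : f.ker = g.ker := by
    ext x
    exact h x
  refine ⟨((QuotientGroup.quotientKerEquivOfSurjective f hf).symm.trans
    (QuotientGroup.quotientMulEquivOfEq hk)).trans
    (QuotientGroup.quotientKerEquivOfSurjective g hg), fun x => ?_⟩
  have : (QuotientGroup.quotientKerEquivOfSurjective f hf).symm (f x) = (x : G ⧸ f.ker) := by
    rw [MulEquiv.symm_apply_eq]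
    rfl
  simp only [MulEquiv.trans_apply, this]
  rfl

lemma exists_induced_action {G P : Type*} [Group G] [Group P] (p : G →* P)
    (hp : Function.Surjective p) (U : Subgroup (MulAut G))
    (hU : ∀ u ∈ U, ∀ x, p x = 1 ↔ p (u x) = 1) :
    ∃ δ : U →* MulAut P, ∀ (u : U) x, δ u (p x) = p (u.1 x) := by
  choose δ hδ using fun u : U => exists_mulEquiv_of_ker_eq p (p.comp (u.1 : G ≃* G).toMonoidHom)
    hp (hp.comp (u.1 : G ≃* G).surjective) (fun x => hU u.1 u.2 x)
  have hδ' : ∀ (u : U) x, δ u (p x) = p (u.1 x) := hδ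
  refine ⟨MonoidHom.mk' δ fun u v => ?_, hδ'⟩
  ext y
  obtain ⟨x, rfl⟩ := hp y
  rw [MulAut.mul_apply, hδ', hδ', hδ']
  rfl

lemma exists_mulEquiv_map {G P : Type*} [Group G] [Group P] (p : G →* P) (H K : Subgroup G)
    (φ : H ≃* K) (hφ : ∀ h : H, p h = 1 ↔ p (φ h) = 1) :
    ∃ φ' : H.map p ≃* K.map p, ∀ h : H,
      ((φ' ⟨p h, mem_map_of_mem p h.2⟩ : K.map p) : P) = p (φ h) := by
  obtain ⟨e, he⟩ := exists_mulEquiv_of_ker_eq (p.subgroupMap H)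
    ((p.subgroupMap K).comp φ.toMonoidHom) (p.subgroupMap_surjective H)
    ((p.subgroupMap_surjective K).comp φ.surjective) (fun h => by
      rw [Subtype.ext_iff, Subtype.ext_iff]
      exact hφ h)
  exact ⟨e, fun h => congrArg Subtype.val (he h)⟩

end InducedMaps

section Joins

variable {C : GroupClass.{u}}

/-- The image of a subgroup generated by two subgroups is a `C`-group as soon as the images of
the generating subgroups are `C`-groups and one of these subgroups is normal. -/
lemma IsRootClass.range_of_sup (hC : IsRootClass C) (hquot : QuotClosed C) {G M : Type u}
    [Group G] [Group M] (A D U : Subgroup G) (hU : U = A ⊔ D) (δ : U →* M)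
    (hA : C ((A.subgroupOf U).map δ)) (hD : C ((D.subgroupOf U).map δ))
    (h : NormalIn A U ∨ NormalIn D U ∨ C U) : C δ.range := by
  have main : ∀ A D : Subgroup G, U = A ⊔ D → C ((A.subgroupOf U).map δ) →
      C ((D.subgroupOf U).map δ) → NormalIn A U → C δ.range := by
    intro A D hU hA hD hn
    have hn' : (A.subgroupOf U).Normal := hn
    have hAn : ((A.subgroupOf U).map δ.rangeRestrict).Normal :=
      hn'.map _ δ.rangeRestrict_surjective
    have hsup : A.subgroupOf U ⊔ D.subgroupOf U = ⊤ := by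
      rw [← subgroupOf_sup (hU ▸ le_sup_left) (hU ▸ le_sup_right), ← hU, subgroupOf_self]
    have hsurj : Function.Surjective
        (((QuotientGroup.mk' ((A.subgroupOf U).map δ.rangeRestrict)).comp
          δ.rangeRestrict).comp (D.subgroupOf U).subtype) := by
      intro y
      obtain ⟨y, rfl⟩ := QuotientGroup.mk'_surjective _ y
      obtain ⟨x, rfl⟩ := δ.rangeRestrict_surjective y
      obtain ⟨a, ha, d, hd, rfl⟩ := mem_sup_of_normal_left.1
        (hsup ▸ mem_top x : x ∈ A.subgroupOf U ⊔ D.subgroupOf U)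
      refine ⟨⟨d, hd⟩, ?_⟩
      rw [map_mul, map_mul]
      have : QuotientGroup.mk' ((A.subgroupOf U).map δ.rangeRestrict) (δ.rangeRestrict a) = 1 :=
        (QuotientGroup.eq_one_iff _).2 (mem_map_of_mem _ ha)
      rw [this, one_mul]
      rfl
    have hCq : C (δ.range ⧸ (A.subgroupOf U).map δ.rangeRestrict) := by
      refine hC.of_surjective hquot (MonoidHom.comp (QuotientGroup.mk' _)
        (inclusion (?_ : (D.subgroupOf U).map δ ≤ δ.range))) ?_ hD
      · exact (map_le_range δ _)
      · intro y
        obtain ⟨d, rfl⟩ := hsurj y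
        exact ⟨⟨δ d, mem_map_of_mem δ d.2⟩, rfl⟩
    refine hC.of_ker (QuotientGroup.mk' ((A.subgroupOf U).map δ.rangeRestrict)) hCq ?_
    rw [QuotientGroup.ker_mk']
    refine hC.of_injective ((δ.range.subtype.comp
      ((A.subgroupOf U).map δ.rangeRestrict).subtype).codRestrict ((A.subgroupOf U).map δ) ?_) ?_ hA
    · rintro ⟨_, a, ha, rfl⟩
      exact ⟨a, ha, rfl⟩
    · intro x y hxy
      have := congrArg Subtype.val hxy
      exact Subtype.ext (Subtype.ext this)
  rcases h with h | h | h
  · exact main A D hU hA hD h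
  · exact main D A (hU.trans (sup_comm A D)) hD hA h
  · exact hC.range hquot δ h

end Joins

section Amalgam

variable {C : GroupClass.{u}}

/-- A twisted wreath product embedding: an extension of `N` is mapped into a wreath product
in such a way that the elements of `N` become constant functions. -/
lemma exists_twisted_wreath_embedding {N A S : Type u} [Group N] [Group A] [Group S] (i : N →* A)
    (hi : Function.Injective i) (π : A →* S) (hker : π.ker = i.range)
    (U : Subgroup (MulAut N)) (hU : ∀ a, ∃ u ∈ U, ∀ n, i (u n) = a * i n * a⁻¹) :
    ∃ f : A →* (N ⋊[U.subtype] U) ≀ᵣ S, (∀ a, (f a).right = π a) ∧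
      ∀ n, f (i n) = ⟨fun _ => SemidirectProduct.inl n, 1⟩ := by
  have haction : ∃ α : A →* U, ∀ a n, i ((α a).1 n) = a * i n * a⁻¹ := by
    choose α hα hα' using hU
    refine ⟨MonoidHom.mk' (fun a => ⟨α a, hα a⟩) fun a b => ?_, hα'⟩
    ext n
    apply hi
    simp [hα', mul_assoc]
  obtain ⟨α, hα⟩ := haction
  have hlog : ∀ x : (π.ker), ∃ n, i n = x := fun x => by
    have : (x : A) ∈ i.range := hker.le x.2
    exact this
  choose l hl using hlog
  have hlog_mul : ∀ x y, l (x * y) = l x * l y := fun x y => hi (by simp [hl])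
  -- a set-theoretic choice of representatives, equivariant modulo `N`
  have hσ : ∃ σ : S → A, ∀ a x, π (σ x * (σ (π a⁻¹ * x))⁻¹) = π a := by
    let r : S → S := fun x => (Quotient.out (Quotient.mk (QuotientGroup.rightRel π.range) x))
    have hr : ∀ x, ∃ a, π a = x * (r x)⁻¹ := by
      intro x
      have h1 : (QuotientGroup.rightRel π.range) (r x) x := Quotient.mk_out x
      rw [QuotientGroup.rightRel_apply] at h1
      exact h1
    have hr' : ∀ a x, r (π a * x) = r x := by
      intro a x
      refine congrArg Quotient.out (Quotient.sound ?_)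
      change (QuotientGroup.rightRel π.range) _ _
      rw [QuotientGroup.rightRel_apply]
      exact ⟨a⁻¹, by simp⟩
    choose σ hσ using hr
    refine ⟨σ, fun a x => ?_⟩
    rw [map_mul, map_inv, hσ, hσ, hr']
    simp
  obtain ⟨σ, hσ⟩ := hσ
  let e : A → S → A := fun a x => σ x * (σ (π a⁻¹ * x))⁻¹
  have he : ∀ a x, a * (e a x)⁻¹ ∈ π.ker := fun a x => by
    rw [MonoidHom.mem_ker, map_mul, map_inv, hσ, mul_inv_cancel]
  have he_mul : ∀ a b x, e (a * b) x = e a x * e b (π a⁻¹ * x) := fun a b x => by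
    simp [e, mul_assoc]
  let F : A → (N ⋊[U.subtype] U) ≀ᵣ S := fun a =>
    ⟨fun x => ⟨l ⟨_, he a x⟩, α (e a x)⟩, π a⟩
  have hF : ∀ a b, F (a * b) = F a * F b := by
    intro a b
    refine RegularWreathProduct.ext (funext fun x => ?_) (map_mul π a b)
    refine SemidirectProduct.ext ?_ ?_
    · apply hi
      simp only [F, RegularWreathProduct.mul_left, Pi.mul_apply, SemidirectProduct.mul_left,
        map_mul, hl, Subgroup.coe_subtype, hα, he_mul, map_inv, mul_inv_rev]
      group
    · simp only [F, RegularWreathProduct.mul_left, Pi.mul_apply, SemidirectProduct.mul_right,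
        he_mul, map_mul, map_inv]
  refine ⟨MonoidHom.mk' F hF, fun _ => rfl, fun n => ?_⟩
  have hn : π (i n) = 1 := by
    have : i n ∈ π.ker := by
      rw [hker]
      exact ⟨n, rfl⟩
    exact this
  have hen : ∀ x, e (i n) x = 1 := fun x => by simp [e, hn]
  refine RegularWreathProduct.ext (funext fun x => ?_) hn
  refine SemidirectProduct.ext ?_ ?_
  · apply hi
    simp [F, hl, hen]
  · simp [F, hen]

/-- Two `C`-groups with a common normal subgroup embed into a `C`-group amalgamating this
subgroup. -/
lemma IsRootClass.exists_amalgam (hC : IsRootClass C) (hquot : QuotClosed C) {N A D : Type u}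
    [Group N] [Group A] [Group D] (hA : C A) (hD : C D) (i : N →* A) (j : N →* D)
    (hi : Function.Injective i) (hj : Function.Injective j)
    (U : Subgroup (MulAut N)) (hCU : C U)
    (hUA : ∀ a, ∃ u ∈ U, ∀ n, i (u n) = a * i n * a⁻¹)
    (hUD : ∀ d, ∃ u ∈ U, ∀ n, j (u n) = d * j n * d⁻¹) :
    ∃ (Y : Type u) (_ : Group Y) (f : A →* Y) (g : D →* Y), C Y ∧ Function.Injective f ∧
      Function.Injective g ∧ ∀ n, f (i n) = g (j n) := by
  have hin : i.range.Normal := ⟨by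
    rintro _ ⟨n, rfl⟩ a
    obtain ⟨u, -, hu⟩ := hUA a
    exact ⟨u n, hu n⟩⟩
  have hjn : j.range.Normal := ⟨by
    rintro _ ⟨n, rfl⟩ a
    obtain ⟨u, -, hu⟩ := hUD a
    exact ⟨u n, hu n⟩⟩
  let S := (A ⧸ i.range) × (D ⧸ j.range)
  let πA : A →* S := (MonoidHom.inl _ _).comp (QuotientGroup.mk' i.range)
  let πD : D →* S := (MonoidHom.inr _ _).comp (QuotientGroup.mk' j.range)
  have hkA : πA.ker = i.range := by
    ext x
    rw [MonoidHom.mem_ker]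
    change (((x : A ⧸ i.range), (1 : D ⧸ j.range)) : S) = (1, 1) ↔ _
    rw [Prod.mk.injEq]
    simp [QuotientGroup.eq_one_iff]
  have hkD : πD.ker = j.range := by
    ext x
    rw [MonoidHom.mem_ker]
    change (((1 : A ⧸ i.range), (x : D ⧸ j.range)) : S) = (1, 1) ↔ _
    rw [Prod.mk.injEq]
    simp [QuotientGroup.eq_one_iff]
  obtain ⟨f, hf, hf'⟩ := exists_twisted_wreath_embedding i hi πA hkA U hUA
  obtain ⟨g, hg, hg'⟩ := exists_twisted_wreath_embedding j hj πD hkD U hUD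
  have hinj : ∀ {P : Type u} [Group P] (k : N →* P) (π : P →* S) (_ : π.ker = k.range)
      (q : P →* (N ⋊[U.subtype] U) ≀ᵣ S) (_ : ∀ a, (q a).right = π a)
      (_ : ∀ n, q (k n) = ⟨fun _ => SemidirectProduct.inl n, 1⟩), Function.Injective q := by
    intro P _ k π hk q hq hq'
    rw [injective_iff_map_eq_one]
    intro x hx
    have hxk : x ∈ π.ker := by
      rw [MonoidHom.mem_ker, ← hq, hx]
      rfl
    rw [hk] at hxk
    obtain ⟨n, rfl⟩ := hxk
    rw [hq'] at hx
    have h1 : (SemidirectProduct.inl n : N ⋊[U.subtype] U) = 1 :=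
      congrFun (congrArg RegularWreathProduct.left hx) 1
    have : n = 1 := congrArg SemidirectProduct.left h1
    simp [this]
  refine ⟨(N ⋊[U.subtype] U) ≀ᵣ S, inferInstance, f, g, ?_, hinj i πA hkA f hf hf',
    hinj j πD hkD g hg hg', fun n => by rw [hf', hg']⟩
  exact hC.wreath (hC.semidirect _ (hC.of_injective i hi hA) hCU)
    (hC.prod (hquot _ _ hA) (hquot _ _ hD))

end Amalgam

section HNNMaps

open HNNExtension

lemma HNNExtension.exists_map {B P : Type*} [Group B] [Group P] {H K : Subgroup B} (φ : H ≃* K)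
    (p : B →* P) (φ' : H.map p ≃* K.map p)
    (hφ' : ∀ h : H, ((φ' ⟨p h, mem_map_of_mem p h.2⟩ : K.map p) : P) = p (φ h)) :
    ∃ m : HNNExtension B H K φ →* HNNExtension P (H.map p) (K.map p) φ',
      (∀ b, m (of b) = of (p b)) ∧ m t = t := by
  refine ⟨lift (of.comp p) t fun h => ?_, fun b => lift_of _ _ _ b, lift_t _ _ _⟩
  have := t_mul_of (φ := φ') ⟨p h, mem_map_of_mem p h.2⟩
  rw [hφ' h] at this
  exact this

/-- Whether an element lies in the base group can be detected in a quotient of the base group as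
soon as finitely many elements are kept outside the images of the associated subgroups. -/
lemma HNNExtension.exists_list_forall_mem_range {B : Type u} [Group B] {H K : Subgroup B}
    (φ : H ≃* K) (g : HNNExtension B H K φ) :
    ∃ l : List B, ∀ {P : Type u} [Group P] (p : B →* P) (φ' : H.map p ≃* K.map p)
      (m : HNNExtension B H K φ →* HNNExtension P (H.map p) (K.map p) φ')
      (_ : ∀ b, m (of b) = of (p b)) (_ : m t = t)
      (_ : ∀ b ∈ l, (p b ∈ H.map p → b ∈ H) ∧ (p b ∈ K.map p → b ∈ K)),
      m g ∈ (of : P →* HNNExtension P (H.map p) (K.map p) φ').range →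
        g ∈ (of : B →* HNNExtension B H K φ).range := by
  obtain ⟨d⟩ := NormalWord.TransversalPair.nonempty B H K
  obtain ⟨w, hw⟩ : ∃ w : NormalWord d, w.prod φ = g := (NormalWord.equiv φ d).symm.surjective g
  subst hw
  refine ⟨w.toList.map Prod.snd, fun {P} _ p φ' m hm hmt hl hmem => ?_⟩
  let w' : NormalWord.ReducedWord P (H.map p) (K.map p) :=
    { head := p w.head
      toList := w.toList.map (Prod.map id p)
      chain := by
        rw [List.isChain_map]
        refine List.IsChain.imp_of_mem_imp (fun a b ha _ hab hpa => hab ?_) w.chain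
        have := hl a.2 (List.mem_map_of_mem ha)
        rcases Int.units_eq_one_or a.1 with h | h
        · simp only [Prod.map_fst, id, h, Prod.map_snd, toSubgroup_one] at hpa ⊢
          exact this.1 hpa
        · simp only [Prod.map_fst, id, h, Prod.map_snd, toSubgroup_neg_one] at hpa ⊢
          exact this.2 hpa }
  have hw' : w'.prod φ' = m (w.prod φ) := by
    simp only [NormalWord.ReducedWord.prod, map_mul, hm, map_list_prod, List.map_map, w']
    congr 3
    funext x
    simp [hm, hmt]
  rw [← hw'] at hmem
  have hnil := ReducedWord.toList_eq_nil_of_mem_of_range φ' w' hmem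
  have hnil' : w.toList = [] := by simpa [w'] using hnil
  exact ⟨w.head, by simp [NormalWord.ReducedWord.prod, hnil']⟩

/-- An HNN-extension whose isomorphism is induced by an inner automorphism embeds into a split
extension of a free group by the base group. -/
lemma HNNExtension.exists_injective_of_conj {X : Type*} [Group X] {H K : Subgroup X} (φ : H ≃* K)
    (τ : X) (hτ : ∀ h : H, (φ h : X) = τ * h * τ⁻¹) :
    ∃ (a : X →* MulAut (FreeGroup (X ⧸ H))) (ν : HNNExtension X H K φ →* FreeGroup (X ⧸ H) ⋊[a] X),
      Function.Injective ν := by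
  let a : X →* MulAut (FreeGroup (X ⧸ H)) := MonoidHom.mk'
    (fun x => FreeGroup.freeGroupCongr (MulAction.toPerm x)) fun x y => by
      refine Eq.trans ?_ (FreeGroup.freeGroupCongr_trans _ _).symm
      congr 1
      ext c
      exact mul_smul x y c
  have ha : ∀ x c, a x (FreeGroup.of c) = FreeGroup.of (x • c) := fun x c => by
    simp [a]
  let s₀ : FreeGroup (X ⧸ H) := FreeGroup.of ((1 : X) : X ⧸ H)
  have hs₀ : ∀ h : H, a h s₀ = s₀ := fun h => by
    rw [ha]
    congr 1
    refine QuotientGroup.eq.2 ?_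
    simp
  let ν : HNNExtension X H K φ →* FreeGroup (X ⧸ H) ⋊[a] X :=
    lift SemidirectProduct.inr (SemidirectProduct.inr τ * SemidirectProduct.inl s₀) fun h => by
      refine SemidirectProduct.ext ?_ ?_
      · simp [hτ, hs₀]
      · simp [hτ]
  let z : HNNExtension X H K φ := (of τ)⁻¹ * t
  have hz : ∀ h ∈ H, of h * z * (of h)⁻¹ = z := fun h hh => by
    have h1 := t_mul_of (φ := φ) ⟨h, hh⟩
    have h2 : (of (φ ⟨h, hh⟩ : X) : HNNExtension X H K φ) = of τ * of h * (of τ)⁻¹ := by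
      rw [hτ, map_mul, map_mul, map_inv]
    rw [h2] at h1
    rw [mul_inv_eq_iff_eq_mul, mul_assoc (of τ)⁻¹, h1]
    simp [z, mul_assoc]
  let σ : FreeGroup (X ⧸ H) →* HNNExtension X H K φ :=
    FreeGroup.lift fun c => of c.out * z * (of c.out)⁻¹
  have hσ : ∀ x c, σ (FreeGroup.of (x • c)) = of x * σ (FreeGroup.of c) * (of x)⁻¹ := by
    intro x c
    have hc : (x * c.out)⁻¹ * (x • c).out ∈ H := by
      rw [← QuotientGroup.eq, QuotientGroup.out_eq', ← smul_eq_mul, ← MulAction.Quotient.smul_coe,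
        QuotientGroup.out_eq']
    have := hz _ hc
    simp only [σ, FreeGroup.lift_apply_of]
    conv_rhs => rw [← this]
    simp [mul_assoc]
  let μ : FreeGroup (X ⧸ H) ⋊[a] X →* HNNExtension X H K φ :=
    SemidirectProduct.lift σ of fun x => by
      ext c
      simp [ha, hσ]
  have hμ : μ.comp ν = MonoidHom.id _ := by
    refine hom_ext ?_ ?_
    · ext x
      simp [μ, ν]
    · have h1 := hz ((1 : X) : X ⧸ H).out (by
        have := QuotientGroup.eq.1 (QuotientGroup.out_eq' ((1 : X) : X ⧸ H)).symm
        rwa [inv_one, one_mul] at this)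
      simp [μ, ν, s₀, σ, h1]
      simp [z]
  refine ⟨a, ν, fun x y hxy => ?_⟩
  rw [← MonoidHom.id_apply _ x, ← hμ, MonoidHom.comp_apply, hxy, ← MonoidHom.comp_apply, hμ,
    MonoidHom.id_apply]

end HNNMaps

section FreeExtension

lemma IsFreeGroup.exists_section {G F : Type*} [Group G] [Group F] [IsFreeGroup F] (f : G →* F)
    (hf : Function.Surjective f) : ∃ s : F →* G, ∀ x, f (s x) = x := by
  refine ⟨IsFreeGroup.lift fun c => (hf (IsFreeGroup.of c)).choose, fun x => ?_⟩
  refine DFunLike.congr_fun (f := f.comp (IsFreeGroup.lift _)) (g := MonoidHom.id F)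
    (IsFreeGroup.ext_hom fun c => ?_) x
  simpa using (hf (IsFreeGroup.of c)).choose_spec

variable {C : GroupClass.{u}}

/-- Let `Λ` be a homomorphism to a split extension of a free group by a `C`-group whose kernel is a
`C`-group. If the group induces a `C`-group of automorphisms on this kernel, then the kernel is
detected by a `C`-group. -/
lemma IsRootClass.exists_hom_injOn_ker (hC : IsRootClass C) {E S X P : Type u} [Group E] [Group X]
    [Group P] (a : X →* MulAut (FreeGroup S)) (Λ : E →* FreeGroup S ⋊[a] X) (hX : C X)
    (v : E →* P) (hP : C P) (hk : C Λ.ker) (hcomm : ∀ e ∈ Λ.ker, ∀ r ∈ v.ker, r * e = e * r) :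
    ∃ (Y : Type u) (_ : Group Y) (q : E →* Y), C Y ∧ ∀ e, q e = 1 → Λ e = 1 → e = 1 := by
  let w : E →* X × P := (SemidirectProduct.rightHom.comp Λ).prod v
  have hw : ∀ r ∈ w.ker, (Λ r).right = 1 ∧ v r = 1 := fun r hr => Prod.ext_iff.1 hr
  let ρ : w.ker →* FreeGroup S := MonoidHom.mk' (fun r => (Λ r.1).left) fun r r' => by
    simp [(hw r r.2).1]
  obtain ⟨s, hs⟩ := IsFreeGroup.exists_section ρ.rangeRestrict ρ.rangeRestrict_surjective
  have hker : ∀ r : w.ker, (r * (s (ρ.rangeRestrict r))⁻¹ : E) ∈ Λ.ker := fun r => by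
    rw [MonoidHom.mem_ker, map_mul, InvMemClass.coe_inv, map_inv, mul_inv_eq_one]
    refine SemidirectProduct.ext ?_ ((hw r r.2).1.trans (hw _ (s _).2).1.symm)
    exact (congrArg Subtype.val (hs (ρ.rangeRestrict r))).symm
  let g : w.ker →* Λ.ker := MonoidHom.mk' (fun r => ⟨_, hker r⟩) fun r r' => by
    have := hcomm _ (hker r') (s (ρ.rangeRestrict r) : E)⁻¹
      (inv_mem (hw _ (s (ρ.rangeRestrict r)).2).2)
    ext
    simp only [map_mul, Subgroup.coe_mul, InvMemClass.coe_inv, mul_inv_rev, mul_assoc] at this ⊢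
    rw [this]
  obtain ⟨Y, _, q, hY, hq⟩ := hC.exists_hom w g (hC.prod hX hP) hk
  refine ⟨Y, _, q, hY, fun e he hΛ => ?_⟩
  obtain ⟨hx, hg⟩ := hq e he
  have h1 : ρ.rangeRestrict ⟨e, hx⟩ = 1 := Subtype.ext (congrArg SemidirectProduct.left hΛ)
  have h2 : (e * (s (ρ.rangeRestrict ⟨e, hx⟩))⁻¹ : E) = 1 := congrArg Subtype.val hg
  simpa [h1] using h2

end FreeExtension

section BaseInClass

open HNNExtension

variable {C : GroupClass.{u}}

/-- The automorphisms of `Y` that leave the intersection of `Y` with a subgroup invariant. -/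
def autPreserving {X : Type*} [Group X] (Y M : Subgroup X) : Subgroup (MulAut Y) where
  carrier := {u | ∀ y : Y, (y : X) ∈ M ↔ (u y : X) ∈ M}
  one_mem' := fun _ => Iff.rfl
  mul_mem' := fun {_ v} hu hv y => (hv y).trans (hu (v y))
  inv_mem' := fun {u} hu y => by
    have := hu (u⁻¹ y)
    rw [MulAut.apply_inv_self] at this
    exact this.symm

lemma Subgroup.Normal.conj_mem_iff {X : Type*} [Group X] {M : Subgroup X} (hM : M.Normal)
    (x y : X) : x * y * x⁻¹ ∈ M ↔ y ∈ M :=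
  ⟨fun h => by simpa [mul_assoc] using hM.conj_mem _ h x⁻¹, fun h => hM.conj_mem _ h x⟩

lemma IsRootClass.exists_hom_of_eq_one_iff (hC : IsRootClass C) (hquot : QuotClosed C)
    {B : Type u} [Group B] (hB : C B) (H K : Subgroup B) [H.Normal] [K.Normal] (φ : H ≃* K)
    (hφ : ∀ h : H, (h : B) ∈ K ↔ (φ h : B) ∈ H) (U : Subgroup (MulAut H)) (hU : C U)
    (hUH : ∀ b : B, ∃ u ∈ U, ∀ h : H, (u h : B) = b * h * b⁻¹)
    (hUK : ∀ b : B, ∃ u ∈ U, ∀ h : H, (φ (u h) : B) = b * φ h * b⁻¹) :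
    ∃ (X : Type u) (_ : Group X) (θ : HNNExtension B H K φ →* X), C X ∧
      ∀ b, θ (of b) = 1 ↔ b ∈ H ⊓ K := by
  have hmk : ∀ x : H, QuotientGroup.mk' (K.subgroupOf H) x = 1 ↔ (x : B) ∈ K := fun x =>
    QuotientGroup.eq_one_iff x
  obtain ⟨δ, hδ⟩ := exists_induced_action (QuotientGroup.mk' (K.subgroupOf H))
    (QuotientGroup.mk'_surjective _) (U ⊓ autPreserving H K) fun u hu x => by
      rw [hmk, hmk]
      exact hu.2 x
  let i : H ⧸ K.subgroupOf H →* B ⧸ K := QuotientGroup.map _ K H.subtype le_rfl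
  let j : H ⧸ K.subgroupOf H →* B ⧸ H :=
    QuotientGroup.map _ H (K.subtype.comp φ.toMonoidHom) fun x hx => (hφ x).1 hx
  have hi : Function.Injective i := by
    rw [injective_iff_map_eq_one]
    intro n hn
    obtain ⟨x, rfl⟩ := QuotientGroup.mk'_surjective _ n
    exact (hmk x).2 ((QuotientGroup.eq_one_iff (x : B)).1 hn)
  have hj : Function.Injective j := by
    rw [injective_iff_map_eq_one]
    intro n hn
    obtain ⟨x, rfl⟩ := QuotientGroup.mk'_surjective _ n
    exact (hmk x).2 ((hφ x).2 ((QuotientGroup.eq_one_iff (φ x : B)).1 hn))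
  obtain ⟨Y, _, f, g, hY, hf, hg, hfg⟩ := hC.exists_amalgam hquot (hquot B K hB) (hquot B H hB)
    i j hi hj δ.range (hC.range hquot δ (hC.of_le inf_le_left hU))
    (fun a => by
      obtain ⟨b, rfl⟩ := QuotientGroup.mk'_surjective _ a
      obtain ⟨u, hu, hub⟩ := hUH b
      refine ⟨_, ⟨⟨u, hu, fun x => ?_⟩, rfl⟩, fun n => ?_⟩
      · rw [hub, Normal.conj_mem_iff ‹_›]
      · obtain ⟨x, rfl⟩ := QuotientGroup.mk'_surjective _ n
        rw [hδ]
        exact congrArg (QuotientGroup.mk' K) (hub x))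
    (fun a => by
      obtain ⟨b, rfl⟩ := QuotientGroup.mk'_surjective _ a
      obtain ⟨u, hu, hub⟩ := hUK b
      refine ⟨_, ⟨⟨u, hu, fun x => ?_⟩, rfl⟩, fun n => ?_⟩
      · rw [hφ, hφ, hub, Normal.conj_mem_iff ‹_›]
      · obtain ⟨x, rfl⟩ := QuotientGroup.mk'_surjective _ n
        rw [hδ]
        exact congrArg (QuotientGroup.mk' H) (hub x))
  obtain ⟨G, _, hG, hGn⟩ := hC.2.1
  obtain ⟨c, hc⟩ := exists_ne (1 : G)
  classical
  let β : B →* Y ≀ᵣ G := MonoidHom.mk'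
    (fun b => ⟨fun x => if x = 1 then f b else if x = c then g b else 1, 1⟩) fun b b' => by
      refine RegularWreathProduct.ext (funext fun x => ?_) (by simp)
      simp only [RegularWreathProduct.mul_left, Pi.mul_apply, inv_one, one_mul]
      split_ifs <;> simp
  have hfH : ∀ h : H, f (h : B) = g (φ h : B) := fun h => hfg (QuotientGroup.mk' _ h)
  refine ⟨Y ≀ᵣ G, inferInstance, lift β ⟨1, c⟩ fun h => ?_, hC.wreath hY hG, fun b => ?_⟩
  · refine RegularWreathProduct.ext (funext fun x => ?_) (by simp [β])
    have h1 : ((h : B) : B ⧸ H) = 1 := (QuotientGroup.eq_one_iff _).2 h.2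
    have h2 : ((φ h : B) : B ⧸ K) = 1 := (QuotientGroup.eq_one_iff _).2 (φ h).2
    have h3 : c⁻¹ * x = 1 ↔ x = c := by rw [inv_mul_eq_one, eq_comm]
    simp only [β, MonoidHom.mk'_apply, RegularWreathProduct.mul_left, Pi.mul_apply, Pi.one_apply,
      h1, h2, map_one, ite_self, one_mul, mul_one, h3, hfH]
    split_ifs <;> simp_all
  · rw [lift_of, RegularWreathProduct.ext_iff, mem_inf, and_comm (a := b ∈ H),
      ← QuotientGroup.eq_one_iff (N := K), ← QuotientGroup.eq_one_iff (N := H),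
      ← map_eq_one_iff f hf, ← map_eq_one_iff g hg]
    constructor
    · rintro ⟨h, -⟩
      refine ⟨?_, ?_⟩
      · simpa [β] using congrFun h 1
      · simpa [β, hc] using congrFun h c
    · rintro ⟨h1, h2⟩
      refine ⟨funext fun x => ?_, rfl⟩
      simp [β, h1, h2]

lemma HNNExtension.exists_conj_action {B : Type u} [Group B] (H K L : Subgroup B) (φ : H ≃* K)
    (hL : H ⊓ K = L) (V : Subgroup (MulAut L))
    (hVB : ∀ b : B, ∃ v ∈ V, ∀ l : L, (v l : B) = b * l * b⁻¹)
    (hVφ : ∃ v ∈ V, ∀ (l : L) (h : (l : B) ∈ H), (v l : B) = φ ⟨l, h⟩) :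
    ∃ v : HNNExtension B H K φ →* V, ∀ e (l : L), of ((v e).1 l : B) = e * of (l : B) * e⁻¹ := by
  choose α hα hα' using hVB
  obtain ⟨τ, hτV, hτ⟩ := hVφ
  have hLH : ∀ l : L, (l : B) ∈ H := fun l => (hL.ge l.2).1
  let β : B →* V := MonoidHom.mk' (fun b => ⟨α b, hα b⟩) fun b b' => by
    ext l
    simp [hα', mul_assoc]
  let v : HNNExtension B H K φ →* V := lift β ⟨τ, hτV⟩ fun h => by
    ext l
    have h1 : (⟨h * l * (h : B)⁻¹, (by
        have := hLH (α h l)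
        rwa [hα'] at this)⟩ : H) = h * ⟨l, hLH l⟩ * h⁻¹ := rfl
    simp [β, hτ _ (hLH _), hα', h1]
  refine ⟨v, fun e => ?_⟩
  induction e using HNNExtension.induction_on with
  | of b =>
    intro l
    simp [v, β, hα']
  | t =>
    intro l
    rw [← equiv_eq_conj ⟨(l : B), hLH l⟩]
    simp [v, hτ l (hLH l)]
  | mul x y hx hy =>
    intro l
    rw [map_mul, Subgroup.coe_mul, MulAut.mul_apply, hx, hy]
    group
  | inv x hx =>
    intro l
    have := hx ((v x)⁻¹.1 l)
    rw [InvMemClass.coe_inv, MulAut.apply_inv_self] at this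
    rw [map_inv, InvMemClass.coe_inv, this]
    group

theorem IsRootClass.residually_hnnExtension (hC : IsRootClass C) (hquot : QuotClosed C)
    {B : Type u} [Group B] (hB : C B) (H K L : Subgroup B) [H.Normal] [K.Normal] (φ : H ≃* K)
    (hL : H ⊓ K = L) (U : Subgroup (MulAut H)) (hU : C U)
    (hUH : ∀ b : B, ∃ u ∈ U, ∀ h : H, (u h : B) = b * h * b⁻¹)
    (hUK : ∀ b : B, ∃ u ∈ U, ∀ h : H, (φ (u h) : B) = b * φ h * b⁻¹)
    (V : Subgroup (MulAut L)) (hV : C V)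
    (hVB : ∀ b : B, ∃ v ∈ V, ∀ l : L, (v l : B) = b * l * b⁻¹)
    (hVφ : ∃ v ∈ V, ∀ (l : L) (h : (l : B) ∈ H), (v l : B) = φ ⟨l, h⟩) :
    Residually C (HNNExtension B H K φ) := by
  have hφ : ∀ h : H, (h : B) ∈ K ↔ (φ h : B) ∈ H := by
    obtain ⟨τ, -, hτ⟩ := hVφ
    intro h
    constructor
    · intro hK
      have h1 := (τ ⟨h, hL.le ⟨h.2, hK⟩⟩).2
      rw [hτ _ h.2] at h1
      exact (hL.ge h1).1
    · intro hH
      obtain ⟨l, hl⟩ := τ.surjective ⟨φ h, hL.le ⟨hH, (φ h).2⟩⟩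
      have h1 := hτ l (hL.ge l.2).1
      rw [hl] at h1
      have h2 : h = ⟨l, (hL.ge l.2).1⟩ := φ.injective (Subtype.ext h1)
      rw [h2]
      exact (hL.ge l.2).2
  obtain ⟨X, _, θ, hX, hθ⟩ := hC.exists_hom_of_eq_one_iff hquot hB H K φ hφ U hU hUH hUK
  let p : B →* X := θ.comp of
  have hp : ∀ b, p b = 1 ↔ b ∈ H ⊓ K := hθ
  have hpH : ∀ M : Subgroup B, H ⊓ K ≤ M → ∀ b, p b ∈ M.map p → b ∈ M := by
    rintro M hM b ⟨x, hx, hxb⟩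
    have : x⁻¹ * b ∈ H ⊓ K := by rw [← hp, map_mul, map_inv, hxb, inv_mul_cancel]
    simpa using M.mul_mem hx (hM this)
  obtain ⟨φ', hφ'⟩ := exists_mulEquiv_map p H K φ fun h => by
    rw [hp, hp, mem_inf, mem_inf, hφ]
    exact ⟨fun h' => ⟨h'.2, (φ h).2⟩, fun h' => ⟨h.2, h'.1⟩⟩
  obtain ⟨m, hm, hmt⟩ := HNNExtension.exists_map φ p φ' hφ'
  obtain ⟨a, ν, hν⟩ := HNNExtension.exists_injective_of_conj φ' (θ t) (by
    rintro ⟨_, h, hh, rfl⟩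
    rw [hφ' ⟨h, hh⟩]
    simp only [p, MonoidHom.comp_apply, ← map_mul, ← map_inv, equiv_eq_conj ⟨h, hh⟩])
  let Λ := ν.comp m
  have hΛ : ∀ e, Λ e = 1 ↔ ∃ l : L, e = of (l : B) := by
    intro e
    constructor
    · intro he
      have he' : m e = 1 := hν (he.trans (map_one ν).symm)
      obtain ⟨l, hl⟩ := HNNExtension.exists_list_forall_mem_range φ e
      obtain ⟨b, rfl⟩ := hl p φ' m hm hmt
        (fun b _ => ⟨hpH H inf_le_left b, hpH K inf_le_right b⟩) (he' ▸ one_mem _)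
      rw [hm, ← map_one of] at he'
      exact ⟨⟨b, hL.le ((hp b).1 (HNNExtension.of_injective _ he'))⟩, rfl⟩
    · rintro ⟨l, rfl⟩
      change ν (m _) = 1
      rw [hm, (hp l).2 (hL.ge l.2), map_one, map_one]
  rw [hC.residually_iff]
  intro g hg
  by_cases hΛg : Λ g = 1
  · obtain ⟨v, hv⟩ := HNNExtension.exists_conj_action H K L φ hL V hVB hVφ
    have hker : C Λ.ker := by
      choose s hs using fun x : Λ.ker => (hΛ x).1 x.2
      have hs' : Function.Injective fun x => (s x : B) := fun x y hxy =>
        Subtype.ext ((hs x).trans ((congrArg of hxy).trans (hs y).symm))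
      refine hC.of_injective (MonoidHom.mk' (fun x => (s x : B)) fun x y => ?_) hs' hB
      apply HNNExtension.of_injective φ
      rw [map_mul, ← hs, ← hs, ← hs]
      rfl
    obtain ⟨Y, _, q, hY, hq⟩ := hC.exists_hom_injOn_ker a Λ hX v hV hker fun e he r hr => by
      obtain ⟨l, rfl⟩ := (hΛ e).1 he
      have h1 := hv r l
      have h2 : v r = 1 := hr
      rw [h2] at h1
      exact (eq_mul_inv_iff_mul_eq.1 h1).symm
    exact ⟨Y, _, q, hY, fun h => hg (hq g h hΛg)⟩
  · obtain ⟨Y, _, f, hY, hf⟩ := hC.exists_semidirect_hom_ne_one a hX (Λ g) hΛg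
    exact ⟨Y, _, f.comp Λ, hY, hf⟩

end BaseInClass

section Reduction

open HNNExtension

variable {C : GroupClass.{u}}

lemma exists_induced_action_map {B P : Type*} [Group B] [Group P] (p : B →* P) (Y : Subgroup B)
    (U : Subgroup (MulAut Y)) (hU : ∀ u ∈ U, ∀ y : Y, p y = 1 ↔ p (u y) = 1) :
    ∃ δ : U →* MulAut (Y.map p), ∀ (u : U) (y : Y),
      (δ u ⟨p y, mem_map_of_mem p y.2⟩ : P) = p (u.1 y) := by
  obtain ⟨δ, hδ⟩ := exists_induced_action (p.subgroupMap Y) (p.subgroupMap_surjective Y) U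
    fun u hu y => by
      rw [Subtype.ext_iff, Subtype.ext_iff]
      exact hU u hu y
  exact ⟨δ, fun u y => congrArg Subtype.val (hδ u y)⟩

lemma IsRootClass.map_autOf (hC : IsRootClass C) (hquot : QuotClosed C) {B P : Type u} [Group B]
    [Group P] (hP : C P) (p : B →* P) (Y : Subgroup B) [(Y.map p).Normal]
    (U : Subgroup (MulAut Y)) (δ : U →* MulAut (Y.map p))
    (hδ : ∀ (u : U) (y : Y), (δ u ⟨p y, mem_map_of_mem p y.2⟩ : P) = p (u.1 y)) :
    C (((autOf B Y).subgroupOf U).map δ) := by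
  refine hC.of_le (T := (MulAut.conjNormal : P →* MulAut (Y.map p)).range) ?_
    (hC.range hquot _ hP)
  rintro _ ⟨u, ⟨b, hb⟩, rfl⟩
  refine ⟨p b, ?_⟩
  ext ⟨_, y, hy, rfl⟩
  rw [hδ u ⟨y, hy⟩]
  have := hb ⟨y, hy⟩
  simp only [Subgroup.coe_subtype] at this
  simp [this]

lemma IsRootClass.map_frakK (hC : IsRootClass C) (hquot : QuotClosed C) {B P : Type u} [Group B]
    [Group P] (hP : C P) (p : B →* P) (H K : Subgroup B) (φ : H ≃* K) [(K.map p).Normal]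
    (φ' : H.map p ≃* K.map p)
    (hφ' : ∀ h : H, ((φ' ⟨p h, mem_map_of_mem p h.2⟩ : K.map p) : P) = p (φ h))
    (U : Subgroup (MulAut H)) (δ : U →* MulAut (H.map p))
    (hδ : ∀ (u : U) (h : H), (δ u ⟨p h, mem_map_of_mem p h.2⟩ : P) = p (u.1 h)) :
    C (((frakK H K φ).subgroupOf U).map δ) := by
  refine hC.of_le
    (T := ((autConjHom φ').comp (MulAut.conjNormal : P →* MulAut (K.map p))).range) ?_
    (hC.range hquot _ hP)
  rintro _ ⟨u, ⟨α, ⟨b, hb⟩, hα⟩, rfl⟩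
  refine ⟨p b, ?_⟩
  ext ⟨_, h, hh, rfl⟩
  congr 1
  apply φ'.injective
  ext
  have h1 : δ u ⟨p h, mem_map_of_mem p hh⟩ = ⟨p (u.1 ⟨h, hh⟩), mem_map_of_mem p (u.1 ⟨h, hh⟩).2⟩ :=
    Subtype.ext (hδ u ⟨h, hh⟩)
  have h2 : (u.1 : MulAut H) = autConjHom φ α := hα.symm
  rw [h1, hφ', h2]
  simp [autConjHom, hb, hφ' ⟨h, hh⟩]

lemma IsRootClass.exists_hom_separating (hC : IsRootClass C) {B : Type u} [Group B]
    (M : Subgroup B) [M.Normal] (hM : Residually C (B ⧸ M)) (b : B) :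
    ∃ (G : Type u) (_ : Group G) (f : B →* G), C G ∧ ∀ x ∈ M, f b = f x → b ∈ M := by
  by_cases hb : b ∈ M
  · obtain ⟨G, _, hG⟩ := hC.exists_trivial
    exact ⟨G, _, 1, hG, fun _ _ _ => hb⟩
  · obtain ⟨G, _, f, -, hG, hf⟩ := hM (QuotientGroup.mk' M b)
      fun h => hb ((QuotientGroup.eq_one_iff b).1 h)
    refine ⟨G, _, f.comp (QuotientGroup.mk' M), hG, fun x hx hbx => absurd ?_ hf⟩
    have hx' : QuotientGroup.mk' M x = 1 := (QuotientGroup.eq_one_iff x).2 hx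
    rw [← MonoidHom.comp_apply, hbx, MonoidHom.comp_apply, hx', map_one]

lemma IsRootClass.exists_hom_separating_list (hC : IsRootClass C) {B : Type u} [Group B]
    (H K : Subgroup B) [H.Normal] [K.Normal] (hH : Residually C (B ⧸ H))
    (hK : Residually C (B ⧸ K)) (l : List B) :
    ∃ (G : Type u) (_ : Group G) (f : B →* G), C G ∧
      ∀ b ∈ l, (∀ x ∈ H, f b = f x → b ∈ H) ∧ (∀ x ∈ K, f b = f x → b ∈ K) := by
  induction l with
  | nil =>
    obtain ⟨G, _, hG⟩ := hC.exists_trivial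
    exact ⟨G, _, 1, hG, by simp⟩
  | cons b l ih =>
    obtain ⟨G₁, _, f₁, hG₁, hf₁⟩ := ih
    obtain ⟨G₂, _, f₂, hG₂, hf₂⟩ := hC.exists_hom_separating H hH b
    obtain ⟨G₃, _, f₃, hG₃, hf₃⟩ := hC.exists_hom_separating K hK b
    refine ⟨_, _, f₁.prod (f₂.prod f₃), hC.prod hG₁ (hC.prod hG₂ hG₃), ?_⟩
    simp only [MonoidHom.prod_apply, Prod.mk.injEq, List.mem_cons, forall_eq_or_imp]
    exact ⟨⟨fun x hx h => hf₂ x hx h.2.1, fun x hx h => hf₃ x hx h.2.2⟩, fun c hc =>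
      ⟨fun x hx h => (hf₁ c hc).1 x hx h.1, fun x hx h => (hf₁ c hc).2 x hx h.1⟩⟩

lemma PreAdmissible.mem_iff {B : Type u} [Group B] {H K : Subgroup B} {φ : H ≃* K}
    {Q : Subgroup B} (hQ : PreAdmissible C H K φ Q) (h : H) : (h : B) ∈ Q ↔ (φ h : B) ∈ Q := by
  obtain ⟨-, hQ, -⟩ := hQ
  constructor
  · intro hh
    have : φ h ∈ (Q ⊓ K).subgroupOf K := hQ.le ⟨h, ⟨hh, h.2⟩, rfl⟩
    exact this.1
  · intro hh
    obtain ⟨x, hx, hxh⟩ := hQ.ge (show φ h ∈ (Q ⊓ K).subgroupOf K from ⟨hh, (φ h).2⟩)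
    rw [← φ.injective hxh]
    exact hx.1

lemma autOf_le_autPreserving {X : Type u} [Group X] (Y M : Subgroup X) [hM : M.Normal] :
    autOf X Y ≤ autPreserving Y M := by
  rintro u ⟨x, hx⟩ y
  rw [hx, hM.conj_mem_iff]

lemma conjNormal_mem_autOf {X : Type u} [Group X] (Y : Subgroup X) [Y.Normal] (x : X) :
    MulAut.conjNormal x ∈ autOf X Y :=
  ⟨x, fun _ => MulAut.conjNormal_apply _ _⟩

theorem IsRootClass.residually_hnnExtension_map (hC : IsRootClass C) (hquot : QuotClosed C)
    {B P : Type u} [Group B] [Group P] {H K : Subgroup B} [H.Normal] [K.Normal] {φ : H ≃* K}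
    {ψ : MulAut ↥(H ⊓ K)} (hψ : IsRestrictionToL H K φ ψ) (hF : C (zpowers ψ))
    (hdag : CondDag C H K φ) (hddag : CondDDag C H K ψ) (p : B →* P)
    (hp : Function.Surjective p) (hP : C P) (hφp : ∀ h : H, p h = 1 ↔ p (φ h) = 1)
    (hL : H.map p ⊓ K.map p = (H ⊓ K).map p) (φ' : H.map p ≃* K.map p)
    (hφ' : ∀ h : H, (φ' ⟨p h, mem_map_of_mem p h.2⟩ : P) = p (φ h)) :
    Residually C (HNNExtension P (H.map p) (K.map p) φ') := by
  have : (H.map p).Normal := Normal.map inferInstance p hp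
  have : (K.map p).Normal := Normal.map inferInstance p hp
  have : ((H ⊓ K).map p).Normal := Normal.map inferInstance p hp
  have hφker : ∀ h : H, (h : B) ∈ p.ker ↔ (φ h : B) ∈ p.ker := hφp
  have hUle : frakU H K φ ≤ autPreserving H p.ker := by
    refine sup_le (autOf_le_autPreserving H p.ker) ?_
    rintro _ ⟨α, ⟨b, hb⟩, rfl⟩ h
    change _ ↔ (φ.symm (α (φ h)) : B) ∈ p.ker
    rw [hφker, hφker, MulEquiv.apply_symm_apply, hb, p.normal_ker.conj_mem_iff]
  have hVle : frakV H K ψ ≤ autPreserving (H ⊓ K) p.ker := by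
    refine sup_le (autOf_le_autPreserving _ p.ker) ?_
    rw [zpowers_le]
    intro l
    rw [hψ]
    exact hφker ⟨l, l.2.1⟩
  obtain ⟨δ, hδ⟩ := exists_induced_action_map p H (frakU H K φ) fun u hu => hUle hu
  obtain ⟨ε, hε⟩ := exists_induced_action_map p (H ⊓ K) (frakV H K ψ) fun v hv => hVle hv
  refine hC.residually_hnnExtension hquot hP (H.map p) (K.map p) ((H ⊓ K).map p) φ' hL
    δ.range ?_ ?_ ?_ ε.range ?_ ?_ ?_
  · exact hC.range_of_sup hquot _ _ _ rfl δ (hC.map_autOf hquot hP p H _ δ hδ)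
      (hC.map_frakK hquot hP p H K φ φ' hφ' _ δ hδ) hdag
  · intro b
    obtain ⟨b, rfl⟩ := hp b
    refine ⟨_, ⟨⟨MulAut.conjNormal b, mem_sup_left (conjNormal_mem_autOf H b)⟩, rfl⟩, ?_⟩
    rintro ⟨_, h, hh, rfl⟩
    rw [hδ _ ⟨h, hh⟩]
    simp
  · intro b
    obtain ⟨b, rfl⟩ := hp b
    refine ⟨_, ⟨⟨autConjHom φ (MulAut.conjNormal b),
      mem_sup_right (mem_map_of_mem _ (conjNormal_mem_autOf K b))⟩, rfl⟩, ?_⟩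
    rintro ⟨_, h, hh, rfl⟩
    rw [show δ _ ⟨p h, _⟩ = ⟨_, mem_map_of_mem p (SetLike.coe_mem _)⟩ from
      Subtype.ext (hδ _ ⟨h, hh⟩), hφ', hφ' ⟨h, hh⟩]
    simp [autConjHom]
  · refine hC.range_of_sup hquot _ _ _ rfl ε (hC.map_autOf hquot hP p _ _ ε hε) ?_ hddag
    refine hC.of_le (T := (ε.comp (inclusion (le_sup_right : zpowers ψ ≤ frakV H K ψ))).range)
      ?_ (hC.range hquot _ hF)
    rintro _ ⟨v, hv, rfl⟩
    exact ⟨⟨v, hv⟩, rfl⟩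
  · intro b
    obtain ⟨b, rfl⟩ := hp b
    refine ⟨_, ⟨⟨MulAut.conjNormal b, mem_sup_left (conjNormal_mem_autOf (H ⊓ K) b)⟩, rfl⟩, ?_⟩
    rintro ⟨_, l, hl, rfl⟩
    rw [hε _ ⟨l, hl⟩]
    simp
  · refine ⟨_, ⟨⟨ψ, mem_sup_right (mem_zpowers ψ)⟩, rfl⟩, ?_⟩
    rintro ⟨_, l, hl, rfl⟩ h
    rw [hε _ ⟨l, hl⟩, hφ' ⟨l, hl.1⟩]
    exact congrArg p (hψ ⟨l, hl⟩)

end Reduction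

theorem statement_14 (C : GroupClass.{u}) (hroot : IsRootClass C) (hquot : QuotClosed C)
    {B : Type u} [Group B] (H K : Subgroup B) (φ : H ≃* K)
    (hH : H.Normal) (hK : K.Normal)
    (ψ : MulAut ↥(H ⊓ K)) (hψ : IsRestrictionToL H K φ ψ)
    (hF : C ↥(Subgroup.zpowers ψ))
    (hdag : CondDag C H K φ) (hddag : CondDDag C H K ψ)
    (hBH : Residually C (B ⧸ H)) (hBK : Residually C (B ⧸ K))
    (hpre : ∀ M : Subgroup B, inCStar C B M →
      ∃ Q : Subgroup B, Q ≤ M ∧ PreAdmissible C H K φ Q) :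
    Residually C (HNNExtension B H K φ) ↔ Residually C B := by
  refine ⟨Residually.of_injective hroot _ (HNNExtension.of_injective φ), fun hB => ?_⟩
  rw [hroot.residually_iff]
  intro g hg
  obtain ⟨l, hl⟩ := HNNExtension.exists_list_forall_mem_range φ g
  obtain ⟨G₁, _, f₁, hG₁, hf₁⟩ := hroot.exists_hom_separating_list H K hBH hBK l
  obtain ⟨G₂, _, f₂, hG₂, hf₂⟩ : ∃ (G : Type u) (_ : Group G) (f : B →* G), C G ∧
      ∀ b, g = HNNExtension.of b → f b ≠ 1 := by
    by_cases hgB : ∃ b, g = HNNExtension.of b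
    · obtain ⟨b, rfl⟩ := hgB
      obtain ⟨G, _, f, -, hG, hf⟩ := hB b fun h => hg (by rw [h, map_one])
      refine ⟨G, _, f, hG, fun c hc => ?_⟩
      rwa [← HNNExtension.of_injective φ hc]
    · obtain ⟨G, _, hG⟩ := hroot.exists_trivial
      exact ⟨G, _, 1, hG, fun b hb => absurd ⟨b, hb⟩ hgB⟩
  obtain ⟨Q, hQf, hQ⟩ := hpre (f₁.prod f₂).ker ⟨inferInstance,
    hroot.of_injective _ (QuotientGroup.kerLift_injective _) (hroot.prod hG₁ hG₂)⟩
  have hQn : Q.Normal := hQ.1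
  have hker : ∀ b, QuotientGroup.mk' Q b = 1 ↔ b ∈ Q := QuotientGroup.eq_one_iff
  have hfQ : ∀ b ∈ Q, f₁ b = 1 ∧ f₂ b = 1 := fun b hb => Prod.ext_iff.1 (hQf hb)
  have hφQ : ∀ h : H, QuotientGroup.mk' Q h = 1 ↔ QuotientGroup.mk' Q (φ h) = 1 := fun h => by
    rw [hker, hker]
    exact hQ.mem_iff h
  obtain ⟨φ', hφ'⟩ := exists_mulEquiv_map (QuotientGroup.mk' Q) H K φ hφQ
  obtain ⟨m, hm, hmt⟩ := HNNExtension.exists_map φ (QuotientGroup.mk' Q) φ' hφ'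
  have hsep : ∀ (M : Subgroup B) b, (∀ x ∈ M, f₁ b = f₁ x → b ∈ M) →
      QuotientGroup.mk' Q b ∈ M.map (QuotientGroup.mk' Q) → b ∈ M := by
    rintro M b h ⟨x, hx, hxb⟩
    refine h x hx (inv_mul_eq_one.1 ?_).symm
    rw [← map_inv, ← map_mul]
    refine (hfQ _ ?_).1
    rw [← hker, map_mul, map_inv, hxb, inv_mul_cancel]
  have hmg : m g ≠ 1 := by
    intro h
    obtain ⟨b, hb⟩ := hl (QuotientGroup.mk' Q) φ' m hm hmt
      (fun b hb => ⟨hsep H b (hf₁ b hb).1, hsep K b (hf₁ b hb).2⟩) (h ▸ one_mem _)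
    rw [← hb, hm, ← map_one HNNExtension.of] at h
    exact hf₂ b hb.symm (hfQ b ((hker b).1 (HNNExtension.of_injective φ' h))).2
  obtain ⟨G, _, f, hG, hf⟩ := hroot.residually_iff.1
    (hroot.residually_hnnExtension_map hquot hψ hF hdag hddag _
      (QuotientGroup.mk'_surjective Q) hQ.2.2.1 hφQ hQ.2.2.2 φ' hφ') (m g) hmg
  exact ⟨G, _, f.comp m, hG, hf⟩
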